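/- Main characterization theorem: an SDR C is Condorcet-consistent if and only if C satisfies top consistency (TC), top symmetry (TS), top monotonicity (TM) and top rationality (TR). -/

import Mathlib

/-- A weak order on `A`: a complete (total) and transitive binary relation. -/
structure WeakOrd (A : Type*) where
  rel : A → A → Prop
  total : ∀ x y, rel x y ∨ rel y x
  trans : ∀ x y z, rel x y → rel y z → rel x z

namespace WeakOrd

variable {A : Type*}

/-- Strict preference. -/
def strict (r : WeakOrd A) (x y : A) : Prop := r.rel x y ∧ ¬ r.rel y x

/-- Indifference. -/
def indiff (r : WeakOrd A) (x y : A) : Prop := r.rel x y ∧ r.rel y x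

open Classical in
/-- The weak order obtained from `r` by moving `x` and `y` strictly above all other
alternatives, preserving the relative ranking of `x` and `y` and of the rest. -/
noncomputable def topShift (r : WeakOrd A) (x y : A) : WeakOrd A where
  rel a b :=
    if a = x ∨ a = y then (if b = x ∨ b = y then r.rel a b else True)
    else if b = x ∨ b = y then False else r.rel a b
  total := by
    intro a b
    by_cases ha : a = x ∨ a = y <;> by_cases hb : b = x ∨ b = y <;>
      simp [ha, hb, r.total a b]
  trans := by
    intro a b c hab hbc
    by_cases ha : a = x ∨ a = y <;> by_cases hb : b = x ∨ b = y <;>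
      by_cases hc : c = x ∨ c = y <;> simp_all <;>
      exact r.trans _ _ _ hab hbc

/-- Relabelling the alternatives of a weak order by a permutation `σ`:
`a` is weakly preferred to `b` in `σ(r)` iff `σ⁻¹ a` is weakly preferred to `σ⁻¹ b` in `r`. -/
def map (σ : Equiv.Perm A) (r : WeakOrd A) : WeakOrd A where
  rel a b := r.rel (σ.symm a) (σ.symm b)
  total := fun _ _ => r.total _ _
  trans := fun _ _ _ hab hbc => r.trans _ _ _ hab hbc

end WeakOrd

/-- A (preference) profile: a weak order for each voter. -/
abbrev Profile (N A : Type*) := N → WeakOrd A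

namespace Profile

variable {N A : Type*}

/-- The top-shift profile `R^{x,y}`. -/
noncomputable def topShift (R : Profile N A) (x y : A) : Profile N A :=
  fun i => (R i).topShift x y

/-- Relabelling alternatives in every voter's preference by a permutation `σ`. -/
def map (σ : Equiv.Perm A) (R : Profile N A) : Profile N A := fun i => (R i).map σ

end Profile

/-- `nwins R x y` is `n(x,y,R)`, the number of voters strictly preferring `x` to `y`. -/
noncomputable def nwins {N A : Type*} (R : Profile N A) (x y : A) : ℕ :=
  Nat.card {i // (R i).strict x y}

/-- The set of Condorcet winners of `R`. -/
def CW {N A : Type*} (R : Profile N A) : Set A :=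
  {x | ∀ y, y ≠ x → nwins R y x ≤ nwins R x y}

/-- Condorcet consistency of a social decision rule. -/
def CondorcetConsistent {N A : Type*} (C : Profile N A → Set A) : Prop :=
  ∀ R : Profile N A, (CW R).Nonempty → C R = CW R

/-- The nice set `N_C(R)`: alternatives selected each time they are top-shifted with any
other alternative. -/
def niceSet {N A : Type*} (C : Profile N A → Set A) (R : Profile N A) : Set A :=
  {x | ∀ y, y ≠ x → x ∈ C (R.topShift x y)}

/-- Weak top consistency (WTC). -/
def WeakTopConsistency {N A : Type*} (C : Profile N A → Set A) : Prop :=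
  ∀ R : Profile N A, niceSet C R ⊆ C R

/-- Top consistency (TC). -/
def TopConsistency {N A : Type*} (C : Profile N A → Set A) : Prop :=
  ∀ R : Profile N A, (niceSet C R).Nonempty → C R = niceSet C R

/-- A 2-profile: two alternatives are unanimously strictly preferred to all others. -/
def IsTwoProfile {N A : Type*} (R : Profile N A) : Prop :=
  ∃ x y : A, x ≠ y ∧
    ∀ z, z ≠ x → z ≠ y → ∀ i, (R i).strict x z ∧ (R i).strict y z

/-- Top anonymity (TA). -/
def TopAnonymity {N A : Type*} (C : Profile N A → Set A) : Prop :=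
  ∀ R : Profile N A, IsTwoProfile R → ∀ π : Equiv.Perm N, C (fun i => R (π i)) = C R

/-- Top neutrality (TN). -/
def TopNeutrality {N A : Type*} (C : Profile N A → Set A) : Prop :=
  ∀ R : Profile N A, IsTwoProfile R → ∀ σ : Equiv.Perm A, C (Profile.map σ R) = σ '' (C R)

/-- Top symmetry (TS): top anonymity and top neutrality. -/
def TopSymmetry {N A : Type*} (C : Profile N A → Set A) : Prop :=
  TopAnonymity C ∧ TopNeutrality C

/-- `Improves R Q x z`, i.e. `R ▷^{x,z} Q`: `Q` is an additional support of `x`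
against `z` from `R` to `Q`. -/
def Improves {N A : Type*} (R Q : Profile N A) (x z : A) : Prop :=
  (∀ i w, ((R i).strict x w → (Q i).strict x w) ∧ ((R i).indiff x w → (Q i).rel x w)) ∧
  ∃ i, (R i).rel z x ∧ (Q i).strict x z

/-- Top monotonicity (TM). -/
def TopMonotonicity {N A : Type*} (C : Profile N A → Set A) : Prop :=
  ∀ (R Q : Profile N A) (x y z : A), x ≠ y → z ≠ x →
    x ∈ C (R.topShift x y) → Improves R Q x z →
    x ∈ C (Q.topShift x y) ∧ z ∉ C (Q.topShift x y)

/-- Top rationality (TR). -/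
def TopRationality {N A : Type*} (C : Profile N A → Set A) : Prop :=
  ∀ (R : Profile N A) (x y : A), x ≠ y → (C (R.topShift x y) ∩ {x, y}).Nonempty

/-- Maskin monotonicity (MM). -/
def MaskinMonotonic {N A : Type*} (C : Profile N A → Set A) : Prop :=
  ∀ (R Q : Profile N A) (x : A), x ∈ C R →
    (∀ i y, ((R i).strict x y → (Q i).strict x y) ∧ ((R i).indiff x y → (Q i).rel x y)) →
    x ∈ C Q

namespace WeakOrd

variable {A : Type*}

theorem eq_of_rel_iff {r s : WeakOrd A} (h : ∀ a b, r.rel a b ↔ s.rel a b) : r = s := by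
  cases r
  cases s
  congr
  funext a b
  exact propext (h a b)

theorem not_strict (r : WeakOrd A) (a b : A) : ¬ r.strict a b ↔ r.rel b a := by
  have := r.total a b
  unfold strict
  tauto

theorem topShift_comm (r : WeakOrd A) (x y : A) : r.topShift x y = r.topShift y x :=
  eq_of_rel_iff fun a b => by grind [topShift]

theorem topShift_idem (r : WeakOrd A) (x y : A) :
    (r.topShift x y).topShift x y = r.topShift x y :=
  eq_of_rel_iff fun a b => by
    by_cases ha : a = x ∨ a = y <;> by_cases hb : b = x ∨ b = y <;> simp [topShift, ha, hb]

theorem map_topShift (σ : Equiv.Perm A) (r : WeakOrd A) (x y : A) :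
    (r.topShift x y).map σ = (r.map σ).topShift (σ x) (σ y) :=
  eq_of_rel_iff fun a b => by
    have h (c z : A) : σ.symm c = z ↔ c = σ z := σ.symm_apply_eq
    by_cases ha : a = σ x ∨ a = σ y <;> by_cases hb : b = σ x ∨ b = σ y <;>
      simp [map, topShift, h, ha, hb]

theorem topShift_strict_pair (r : WeakOrd A) (x y : A) :
    (r.topShift x y).strict x y ↔ r.strict x y := by
  simp [strict, topShift]

theorem topShift_strict_other (r : WeakOrd A) {x y z : A} (hx : z ≠ x) (hy : z ≠ y) :
    (r.topShift x y).strict x z := by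
  simp [strict, topShift, hx, hy]

theorem topShift_eq_self {r : WeakOrd A} {x y : A}
    (h : ∀ z, z ≠ x → z ≠ y → r.strict x z ∧ r.strict y z) : r.topShift x y = r :=
  eq_of_rel_iff fun a b => by
    by_cases ha : a = x ∨ a = y <;> by_cases hb : b = x ∨ b = y <;>
      simp only [topShift, ha, hb, if_true, if_false, true_iff, false_iff]
    · obtain ⟨hbx, hby⟩ := not_or.mp hb
      rcases ha with rfl | rfl
      exacts [(h b hbx hby).1.1, (h b hbx hby).2.1]
    · obtain ⟨hax, hay⟩ := not_or.mp ha
      rcases hb with rfl | rfl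
      exacts [(h a hax hay).1.2, (h a hax hay).2.2]

open Classical in
/-- The weak order obtained from `r` by moving `x` and `y` strictly below all other
alternatives, preserving the relative ranking of `x` and `y` and of the rest. -/
noncomputable def bottomShift (r : WeakOrd A) (x y : A) : WeakOrd A where
  rel a b :=
    if a = x ∨ a = y then (if b = x ∨ b = y then r.rel a b else False)
    else if b = x ∨ b = y then True else r.rel a b
  total := by
    intro a b
    by_cases ha : a = x ∨ a = y <;> by_cases hb : b = x ∨ b = y <;>
      simp [ha, hb, r.total a b]
  trans := by
    intro a b c hab hbc
    by_cases ha : a = x ∨ a = y <;> by_cases hb : b = x ∨ b = y <;>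
      by_cases hc : c = x ∨ c = y <;> simp_all <;>
      exact r.trans _ _ _ hab hbc

theorem topShift_bottomShift (r : WeakOrd A) (x y : A) :
    (r.bottomShift x y).topShift x y = r.topShift x y :=
  eq_of_rel_iff fun a b => by
    by_cases ha : a = x ∨ a = y <;> by_cases hb : b = x ∨ b = y <;>
      simp only [topShift, bottomShift, ha, hb, if_true, if_false]

end WeakOrd

section

variable {N A : Type*}

namespace Profile

theorem topShift_comm (R : Profile N A) (x y : A) : R.topShift x y = R.topShift y x :=
  funext fun i => (R i).topShift_comm x y

theorem isTwoProfile_topShift (R : Profile N A) {x y : A} (hxy : x ≠ y) :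
    IsTwoProfile (R.topShift x y) := by
  refine ⟨x, y, hxy, fun z hx hy i => ⟨(R i).topShift_strict_other hx hy, ?_⟩⟩
  rw [topShift_comm]
  exact (R i).topShift_strict_other hy hx

end Profile

theorem IsTwoProfile.exists_topShift_eq {R : Profile N A} (hR : IsTwoProfile R) :
    ∃ x y, x ≠ y ∧ R.topShift x y = R := by
  obtain ⟨x, y, hxy, h⟩ := hR
  exact ⟨x, y, hxy, funext fun i => WeakOrd.topShift_eq_self fun z hx hy => h z hx hy i⟩

theorem nwins_topShift_left (R : Profile N A) (x y : A) :
    nwins (R.topShift x y) x y = nwins R x y :=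
  Nat.card_congr (Equiv.subtypeEquivRight fun i => (R i).topShift_strict_pair x y)

theorem nwins_topShift_right (R : Profile N A) (x y : A) :
    nwins (R.topShift x y) y x = nwins R y x := by
  rw [Profile.topShift_comm, nwins_topShift_left]

theorem nwins_topShift_top_other (R : Profile N A) {x y z : A} (hx : z ≠ x) (hy : z ≠ y) :
    nwins (R.topShift x y) x z = Nat.card N :=
  Nat.card_congr (Equiv.subtypeUnivEquiv fun i => (R i).topShift_strict_other hx hy)

theorem nwins_topShift_other_top (R : Profile N A) {x y z : A} (hx : z ≠ x) (hy : z ≠ y) :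
    nwins (R.topShift x y) z x = 0 := by
  have : IsEmpty {i // (R.topShift x y i).strict z x} :=
    ⟨fun i => i.2.2 ((R i.1).topShift_strict_other hx hy).1⟩
  exact Nat.card_of_isEmpty

theorem mem_CW_topShift (R : Profile N A) {x y : A} (hxy : x ≠ y) :
    x ∈ CW (R.topShift x y) ↔ nwins R y x ≤ nwins R x y := by
  refine ⟨fun h => ?_, fun h z hz => ?_⟩
  · simpa only [nwins_topShift_left, nwins_topShift_right] using h y hxy.symm
  · by_cases hzy : z = y
    · subst hzy
      rwa [nwins_topShift_left, nwins_topShift_right]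
    · rw [nwins_topShift_other_top R hz hzy]
      exact Nat.zero_le _

theorem CW_topShift_inter_nonempty (R : Profile N A) {x y : A} (hxy : x ≠ y) :
    (CW (R.topShift x y) ∩ {x, y}).Nonempty := by
  rcases le_total (nwins R y x) (nwins R x y) with h | h
  · exact ⟨x, (mem_CW_topShift R hxy).2 h, by simp⟩
  · refine ⟨y, ?_, by simp⟩
    rw [Profile.topShift_comm]
    exact (mem_CW_topShift R hxy.symm).2 h

theorem IsTwoProfile.CW_nonempty {R : Profile N A} (hR : IsTwoProfile R) : (CW R).Nonempty := by
  obtain ⟨x, y, hxy, h⟩ := hR.exists_topShift_eq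
  rw [← h]
  exact (CW_topShift_inter_nonempty R hxy).mono Set.inter_subset_left

theorem IsTwoProfile.comp_perm {R : Profile N A} (hR : IsTwoProfile R) (π : Equiv.Perm N) :
    IsTwoProfile fun i => R (π i) := by
  obtain ⟨x, y, hxy, h⟩ := hR
  exact ⟨x, y, hxy, fun z hx hy i => h z hx hy (π i)⟩

theorem IsTwoProfile.map {R : Profile N A} (hR : IsTwoProfile R) (σ : Equiv.Perm A) :
    IsTwoProfile (R.map σ) := by
  obtain ⟨x, y, hxy, h⟩ := hR
  refine ⟨σ x, σ y, σ.injective.ne hxy, fun z hx hy i => ?_⟩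
  have := h (σ.symm z) (fun e => hx (by simp [← e])) (fun e => hy (by simp [← e])) i
  simpa [WeakOrd.strict, Profile.map, WeakOrd.map] using this

theorem CW_comp_perm (R : Profile N A) (π : Equiv.Perm N) : CW (fun i => R (π i)) = CW R := by
  have h (a b : A) : nwins (fun i => R (π i)) a b = nwins R a b :=
    Nat.card_congr (π.subtypeEquiv fun _ => Iff.rfl)
  simp only [CW, h]

theorem CW_map (R : Profile N A) (σ : Equiv.Perm A) : CW (R.map σ) = σ '' CW R := by
  have h (a b : A) : nwins (R.map σ) a b = nwins R (σ.symm a) (σ.symm b) := rfl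
  ext a
  rw [Equiv.image_eq_preimage_symm]
  simp only [CW, Set.mem_ofPred_eq, Set.mem_preimage, h]
  refine ⟨fun H b hb => ?_, fun H b hb => H _ (σ.symm.injective.ne hb)⟩
  simpa using H (σ b) (fun e => hb (by simp [← e]))

/-- If `C` decides the two shifted alternatives of every top-shift by majority, then its nice
set is the set of Condorcet winners. -/
theorem niceSet_eq_CW {C : Profile N A → Set A}
    (h : ∀ (R : Profile N A) (x y : A), x ≠ y →
      (x ∈ C (R.topShift x y) ↔ nwins R y x ≤ nwins R x y)) (R : Profile N A) :
    niceSet C R = CW R := by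
  ext x
  exact forall₂_congr fun y hy => h R x y hy.symm

namespace CondorcetConsistent

variable {C : Profile N A → Set A}

theorem eq_CW (hC : CondorcetConsistent C) {R : Profile N A} (hR : IsTwoProfile R) :
    C R = CW R :=
  hC R hR.CW_nonempty

theorem topShift_eq_CW (hC : CondorcetConsistent C) (R : Profile N A) {x y : A} (hxy : x ≠ y) :
    C (R.topShift x y) = CW (R.topShift x y) :=
  hC.eq_CW (R.isTwoProfile_topShift hxy)

theorem topConsistency (hC : CondorcetConsistent C) : TopConsistency C := by
  have h := niceSet_eq_CW (C := C) fun R x y hxy => by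
    rw [hC.topShift_eq_CW R hxy, mem_CW_topShift R hxy]
  intro R hR
  rw [h] at hR ⊢
  exact hC R hR

theorem topSymmetry (hC : CondorcetConsistent C) : TopSymmetry C := by
  refine ⟨fun R hR π => ?_, fun R hR σ => ?_⟩
  · rw [hC.eq_CW hR, hC.eq_CW (hR.comp_perm π), CW_comp_perm]
  · rw [hC.eq_CW hR, hC.eq_CW (hR.map σ), CW_map]

theorem topRationality (hC : CondorcetConsistent C) : TopRationality C := by
  intro R x y hxy
  rw [hC.topShift_eq_CW R hxy]
  exact CW_topShift_inter_nonempty R hxy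

theorem topMonotonicity [Finite N] [Nonempty N] (hC : CondorcetConsistent C) :
    TopMonotonicity C := by
  intro R Q x y z hxy hzx hx hRQ
  obtain ⟨hweak, i, hi, hi'⟩ := hRQ
  rw [hC.topShift_eq_CW R hxy, mem_CW_topShift R hxy] at hx
  rw [hC.topShift_eq_CW Q hxy, mem_CW_topShift Q hxy]
  have hsub : {j | (R j).strict x y} ⊆ {j | (Q j).strict x y} := fun j => (hweak j y).1
  have hsub' : {j | (Q j).strict y x} ⊆ {j | (R j).strict y x} := by
    intro j hj
    by_contra hn
    have hxy' := (WeakOrd.not_strict _ _ _).1 hn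
    by_cases hyx : (R j).rel y x
    · exact hj.2 ((hweak j y).2 ⟨hxy', hyx⟩)
    · exact hj.2 ((hweak j y).1 ⟨hxy', hyx⟩).1
  have hle : nwins R x y ≤ nwins Q x y := Set.ncard_le_ncard hsub
  have hle' : nwins Q y x ≤ nwins R y x := Set.ncard_le_ncard hsub'
  refine ⟨by omega, fun hz => ?_⟩
  by_cases hzy : z = y
  · subst hzy
    have hlt : nwins R x z < nwins Q x z :=
      Set.ncard_lt_ncard ⟨hsub, fun h => (h hi' : (R i).strict x z).2 hi⟩
    rw [Profile.topShift_comm, mem_CW_topShift Q hzx] at hz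
    omega
  · have := hz x hzx.symm
    rw [nwins_topShift_top_other Q hzx hzy, nwins_topShift_other_top Q hzx hzy] at this
    exact Nat.card_pos.ne' (Nat.le_zero.1 this)

end CondorcetConsistent

/-- An alternative `x` chosen in the top-shift of `P` by `x` and `y` stays chosen in that of `Q`
if its position against `y` does not deteriorate, and excludes `y` if it improves. -/
theorem TopMonotonicity.of_pair [Nonempty N] {C : Profile N A → Set A}
    (hC : TopMonotonicity C) {x y z : A} (hxy : x ≠ y) (hzx : z ≠ x) (hzy : z ≠ y)
    {P Q : Profile N A} (hx : x ∈ C (P.topShift x y))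
    (hs : ∀ i, (P i).strict x y → (Q i).strict x y)
    (hw : ∀ i, (P i).rel x y → (Q i).rel x y) :
    x ∈ C (Q.topShift x y) ∧
      ((∃ i, (P i).rel y x ∧ (Q i).strict x y) → y ∉ C (Q.topShift x y)) := by
  let P' : Profile N A := fun i => (P i).bottomShift x y
  have hP' : P'.topShift x y = P.topShift x y := funext fun i => (P i).topShift_bottomShift x y
  have hQ' : (Q.topShift x y).topShift x y = Q.topShift x y :=
    funext fun i => (Q i).topShift_idem x y
  have himp : ∀ i w, ((P' i).strict x w → (Q.topShift x y i).strict x w) ∧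
      ((P' i).indiff x w → (Q.topShift x y i).rel x w) := by
    intro i w
    by_cases hwx : w = x
    · subst hwx
      exact ⟨fun h => absurd h.1 h.2, fun _ => ((Q.topShift w y i).total w w).elim id id⟩
    by_cases hwy : w = y
    · subst hwy
      have h1 := hs i
      have h2 := hw i
      simp only [WeakOrd.strict] at h1
      simpa [P', Profile.topShift, WeakOrd.strict, WeakOrd.indiff, WeakOrd.topShift,
        WeakOrd.bottomShift] using And.intro h1 fun h _ => h2 h
    · simp [P', WeakOrd.strict, WeakOrd.indiff, WeakOrd.bottomShift, hwx, hwy]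
  rw [← hP'] at hx
  rw [← hQ']
  refine ⟨?_, ?_⟩
  · obtain ⟨i⟩ := ‹Nonempty N›
    refine (hC P' _ x y z hxy hzx hx ⟨himp, i, ?_, (Q i).topShift_strict_other hzx hzy⟩).1
    simp [P', WeakOrd.bottomShift, hzx, hzy]
  · rintro ⟨i, hi, hi'⟩
    refine (hC P' _ x y y hxy hxy.symm hx ⟨himp, i, ?_, ((Q i).topShift_strict_pair x y).2 hi'⟩).2
    simpa [P', WeakOrd.bottomShift] using hi

/-- If `q` holds at most as often as `p` and is disjoint from `p`, some permutation exchanges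
the points satisfying `q` with points satisfying `p`. -/
theorem exists_perm_exchange [Finite N] {p q : N → Prop} (hpq : ∀ i, q i → ¬ p i)
    (hcard : Nat.card {i // q i} ≤ Nat.card {i // p i}) :
    ∃ π : Equiv.Perm N, (∀ i, q i → p (π i)) ∧ ∀ i, q (π i) → p i := by
  classical
  have := Fintype.ofFinite N
  rw [Nat.card_eq_fintype_card, Nat.card_eq_fintype_card] at hcard
  obtain ⟨e⟩ := Function.Embedding.nonempty_of_card_le hcard
  let f : N → N := fun i =>
    if h : q i then e ⟨i, h⟩ else if h : ∃ j, (e j : N) = i then h.choose else i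
  have hf (j : {i // q i}) : f j = e j := by simp [f, j.2]
  have hf' (j : {i // q i}) : f (e j) = j := by
    have hex : ∃ k, (e k : N) = e j := ⟨j, rfl⟩
    have hk : hex.choose = j := e.injective (Subtype.ext hex.choose_spec)
    have hn : ¬ q (e j) := fun h => hpq _ h (e j).2
    simp only [f, dif_neg hn, dif_pos hex, hk]
  have hinv : Function.Involutive f := by
    intro i
    by_cases h : q i
    · exact (congrArg f (hf ⟨i, h⟩)).trans (hf' ⟨i, h⟩)
    by_cases h' : ∃ j, (e j : N) = i
    · obtain ⟨j, rfl⟩ := h'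
      rw [hf', hf]
    · have : f i = i := by simp only [f, dif_neg h, dif_neg h']
      rw [this, this]
  have hmaps (i : N) (h : q i) : p (f i) := by
    rw [hf ⟨i, h⟩]
    exact (e ⟨i, h⟩).2
  refine ⟨hinv.toPerm, hmaps, fun i h => ?_⟩
  have := hmaps _ h
  rwa [Function.Involutive.coe_toPerm, hinv i] at this

/-- If `y` is chosen in the top-shift of `R` by `x` and `y` and does not beat `x` by majority,
then `x` is chosen too, and `x` does not beat `y` either. -/
theorem mem_topShift_of_mem_topShift [Finite N] [Nonempty N] {C : Profile N A → Set A}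
    (hTS : TopSymmetry C) (hTM : TopMonotonicity C) {x y z : A} (hxy : x ≠ y) (hzx : z ≠ x)
    (hzy : z ≠ y) {R : Profile N A} (hle : nwins R y x ≤ nwins R x y)
    (hy : y ∈ C (R.topShift x y)) :
    x ∈ C (R.topShift x y) ∧ nwins R x y = nwins R y x := by
  classical
  let σ : Equiv.Perm A := Equiv.swap x y
  obtain ⟨π, hπ, hπ'⟩ := exists_perm_exchange (p := fun i => (R i).strict x y)
    (q := fun i => (R i).strict y x) (fun i h h' => h.2 h'.1) hle
  let P : Profile N A := fun i => R.map σ (π i)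
  have hrel : ∀ i, ((P i).rel x y ↔ (R (π i)).rel y x) ∧ ((P i).rel y x ↔ (R (π i)).rel x y) := by
    intro i
    simp [P, σ, Profile.map, WeakOrd.map]
  have hmap : (R.topShift x y).map σ = (R.map σ).topShift x y := by
    funext i
    have := (R i).map_topShift σ x y
    rw [Equiv.swap_apply_left, Equiv.swap_apply_right, ((R i).map σ).topShift_comm] at this
    exact this
  have hxP : x ∈ C (P.topShift x y) := by
    have h := hTS.1 _ ((R.map σ).isTwoProfile_topShift hxy) π
    have h' := hTS.2 _ (R.isTwoProfile_topShift hxy) σ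
    rw [hmap] at h'
    change C (P.topShift x y) = _ at h
    rw [h, h']
    exact ⟨y, hy, Equiv.swap_apply_right x y⟩
  have key := hTM.of_pair (Q := R) hxy hzx hzy hxP
    (fun i h => hπ' i ⟨(hrel i).1.1 h.1, fun hn => h.2 ((hrel i).2.2 hn)⟩)
    (fun i h => by
      rw [← WeakOrd.not_strict]
      exact fun hn => (hπ i hn).2 ((hrel i).1.1 h))
  refine ⟨key.1, hle.antisymm' ?_⟩
  by_contra hlt
  refine key.2 ?_ hy
  by_contra! hno
  apply hlt
  refine Nat.card_le_card_of_injective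
    (fun i : {i // (R i).strict x y} => (⟨π i, ?_⟩ : {i // (R i).strict y x}))
    fun i j h => Subtype.ext (π.injective (congrArg Subtype.val h))
  by_contra hn
  exact hno i ((hrel i).2.2 ((WeakOrd.not_strict _ _ _).1 hn)) i.2

end

/-- **Main characterization.** An SDR is Condorcet-consistent if and
only if it satisfies TC, TS, TM and TR. -/
theorem stmt_6 {N A : Type*} [Fintype N] [Fintype A]
    (hN : 2 ≤ Fintype.card N) (hA : 3 ≤ Fintype.card A)
    (C : Profile N A → Set A) (hCne : ∀ R, (C R).Nonempty) :
    CondorcetConsistent C ↔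
      (TopConsistency C ∧ TopSymmetry C ∧ TopMonotonicity C ∧ TopRationality C) := by
  have : Nonempty N := Fintype.card_pos_iff.1 (by omega)
  refine ⟨fun hC => ⟨hC.topConsistency, hC.topSymmetry, hC.topMonotonicity, hC.topRationality⟩,
    fun ⟨hTC, hTS, hTM, hTR⟩ => ?_⟩
  have hthird (x y : A) : ∃ z, z ≠ x ∧ z ≠ y := by
    classical
    obtain ⟨z, hz⟩ := Finset.exists_mem_notMem_of_card_lt_card (s := {x, y}) (t := Finset.univ)
      (Finset.card_le_two.trans_lt (by rw [Finset.card_univ]; omega))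
    exact ⟨z, by simpa using hz⟩
  have hnice := niceSet_eq_CW (C := C) fun R x y hxy => by
    obtain ⟨z, hzx, hzy⟩ := hthird x y
    refine ⟨fun hx => ?_, fun hle => ?_⟩
    · by_contra! hlt
      rw [Profile.topShift_comm] at hx
      exact hlt.ne' (mem_topShift_of_mem_topShift hTS hTM hxy.symm hzy hzx hlt.le hx).2
    · obtain ⟨w, hw, rfl | rfl⟩ := hTR R x y hxy
      · exact hw
      · exact (mem_topShift_of_mem_topShift hTS hTM hxy hzx hzy hle hw).1
  intro R hR
  rw [← hnice] at hR ⊢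
  exact hTC R hR
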